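/- For every integer s ≥ 0, the intertwining relation E^s · 𝐑̃^⊤ = 𝐑̃^⊤ · 𝐓^s holds, where 𝐓 := (𝐑 − 𝐐) 𝐑̃^⊤. -/

import Mathlib

open Matrix

/-- The product of a block row and a block column is the sum of the blockwise products. -/
theorem Matrix.mul_eq_sum_mul_of_blocks {ι m n α : Type*} {κ : ι → Type*} [Fintype ι]
    [∀ i, Fintype (κ i)] [NonUnitalNonAssocSemiring α]
    {X : Matrix m (Σ i, κ i) α} {Y : Matrix (Σ i, κ i) n α}
    {x : ∀ i, Matrix m (κ i) α} {y : ∀ i, Matrix (κ i) n α}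
    (hX : ∀ p i q, X p ⟨i, q⟩ = x i p q) (hY : ∀ i q p, Y ⟨i, q⟩ p = y i q p) :
    X * Y = ∑ i, x i * y i := by
  ext a b
  simp [Matrix.mul_apply, Matrix.sum_apply, Fintype.sum_sigma, hX, hY]

/-- Push-through identity for powers of products of rectangular matrices. -/
theorem Matrix.mul_pow_mul_eq_mul_mul_pow {m n α : Type*} [Fintype m] [Fintype n]
    [DecidableEq m] [DecidableEq n] [Semiring α] (X : Matrix m n α) (Y : Matrix n m α) (s : ℕ) :
    (X * Y) ^ s * X = X * (Y * X) ^ s := by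
  induction s with
  | zero => simp
  | succ k ih =>
    rw [pow_succ', pow_succ, Matrix.mul_assoc, ih, ← pow_succ, pow_succ']
    simp only [Matrix.mul_assoc]

/-- For every integer `s ≥ 0`, the intertwining relation `E^s 𝐑̃ᵀ = 𝐑̃ᵀ 𝐓^s` holds,
where `E = I − B⁻¹A` and `𝐓 = (𝐑 − 𝐐) 𝐑̃ᵀ`. -/
theorem oras_power_intertwining
    (N M : ℕ) (hN : 0 < N) (hM : 0 < M)
    (Mloc : Fin N → ℕ) (hMloc : ∀ ℓ, 0 < Mloc ℓ)
    (A : Matrix (Fin M) (Fin M) ℂ)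
    (Aloc : ∀ ℓ : Fin N, Matrix (Fin (Mloc ℓ)) (Fin (Mloc ℓ)) ℂ)
    (hAloc : ∀ ℓ, IsUnit (Aloc ℓ))
    (R Rt : ∀ ℓ : Fin N, Matrix (Fin (Mloc ℓ)) (Fin M) ℂ)
    (hPOU : ∑ ℓ, (Rt ℓ)ᵀ * R ℓ = (1 : Matrix (Fin M) (Fin M) ℂ))
    (bigR bigQ : Matrix (Σ ℓ : Fin N, Fin (Mloc ℓ)) (Fin M) ℂ)
    (bigRt : Matrix (Fin M) (Σ ℓ : Fin N, Fin (Mloc ℓ)) ℂ)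
    (hbigR : ∀ (ℓ : Fin N) (q : Fin (Mloc ℓ)) (p : Fin M), bigR ⟨ℓ, q⟩ p = R ℓ q p)
    (hbigQ : ∀ (ℓ : Fin N) (q : Fin (Mloc ℓ)) (p : Fin M),
      bigQ ⟨ℓ, q⟩ p = ((Aloc ℓ)⁻¹ * R ℓ * A) q p)
    (hbigRt : ∀ (p : Fin M) (ℓ : Fin N) (q : Fin (Mloc ℓ)), bigRt p ⟨ℓ, q⟩ = (Rt ℓ)ᵀ p q) :
    ∀ s : ℕ,
      ((1 : Matrix (Fin M) (Fin M) ℂ) - (∑ ℓ, (Rt ℓ)ᵀ * (Aloc ℓ)⁻¹ * R ℓ) * A) ^ s * bigRt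
        = bigRt * ((bigR - bigQ) * bigRt) ^ s := by
  intro s
  have hE : (1 : Matrix (Fin M) (Fin M) ℂ) - (∑ ℓ, (Rt ℓ)ᵀ * (Aloc ℓ)⁻¹ * R ℓ) * A
      = bigRt * (bigR - bigQ) := by
    rw [Matrix.mul_sub, Matrix.mul_eq_sum_mul_of_blocks hbigRt hbigR,
      Matrix.mul_eq_sum_mul_of_blocks hbigRt hbigQ, hPOU, Matrix.sum_mul]
    simp only [Matrix.mul_assoc]
  rw [hE, Matrix.mul_pow_mul_eq_mul_mul_pow]
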